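/- arXiv:2012.02591 — 7 statements merged into one kernel-verified Lean document; each statement's English description precedes it below -/
import Mathlib

section
/- For every real number β, the integral over the cube [0,2π]^6 ⊂ ℝ^6 (with respect to Lebesgue measure) of the function Π_β(θ) = (1+β sin(θ₁+θ₂))(1+β sin(θ₂+θ₃))(1+β cos(θ₃+θ₄))(1−β sin(θ₄+θ₅))(1−β sin(θ₅+θ₆))(1+β cos(θ₆+θ₁)) equals (2π)^6 + 2π^6 β^6. -/
open MeasureTheory Real

lemma integral_mul_trig (A p q C r s : ℝ) :
    ∫ x in (0:ℝ)..2*π, (A + p * cos x + q * sin x) * (C + r * cos x + s * sin x)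
      = 2*π*(A*C) + π*(p*r + q*s) := by
  have key (x : ℝ) : HasDerivAt
      (fun x => A*C*x + (A*r + p*C) * sin x - (A*s + q*C) * cos x
        + p*r * ((x + sin x * cos x)/2) + q*s * ((x - sin x * cos x)/2)
        + (p*s + q*r) * (sin x ^ 2 / 2))
      ((A + p * cos x + q * sin x) * (C + r * cos x + s * sin x)) x := by
    have hs := hasDerivAt_sin x
    have hc := hasDerivAt_cos x
    have hi := hasDerivAt_id' x
    have hsc := hs.mul hc
    refine HasDerivAt.congr_deriv ((((((hi.const_mul (A*C)).add (hs.const_mul (A*r + p*C))).sub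
      (hc.const_mul (A*s + q*C))).add (((hi.add hsc).div_const 2).const_mul (p*r))).add
      (((hi.sub hsc).div_const 2).const_mul (q*s))).add
      (((hs.pow 2).div_const 2).const_mul (p*s + q*r))) ?_
    push_cast
    linear_combination ((p*r+q*s)/2) * (sin_sq_add_cos_sq x).symm
  rw [intervalIntegral.integral_eq_sub_of_hasDerivAt (fun x _ => key x)
    (Continuous.intervalIntegrable (by fun_prop) _ _)]
  simp only [sin_two_pi, cos_two_pi, sin_zero, cos_zero]
  ring

lemma setIntegral_box_succ {n : ℕ} {a b : ℝ} (hab : a ≤ b) {f : (Fin (n + 1) → ℝ) → ℝ}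
    (hf : Continuous f) {g : (Fin n → ℝ) → ℝ}
    (h : ∀ y, ∫ x in a..b, f (Fin.cons x y) = g y) :
    ∫ θ in Set.univ.pi (fun _ => Set.Icc a b), f θ
      = ∫ y in Set.univ.pi (fun _ => Set.Icc a b), g y := by
  have e := (volume_preserving_piFinSuccAbove (fun _ : Fin (n + 1) => ℝ) 0).symm
  have hcons (z : ℝ × (Fin n → ℝ)) :
      (MeasurableEquiv.piFinSuccAbove (fun _ : Fin (n + 1) => ℝ) 0).symm z
        = Fin.cons z.1 z.2 := Fin.insertNth_zero' z.1 z.2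
  have hpre : (MeasurableEquiv.piFinSuccAbove (fun _ : Fin (n + 1) => ℝ) 0).symm ⁻¹'
      (Set.univ.pi fun _ => Set.Icc a b)
      = Set.Icc a b ×ˢ Set.univ.pi (fun _ => Set.Icc a b) := by
    ext ⟨x, y⟩
    rw [Set.mem_preimage, hcons, Set.mem_pi]
    simp only [Set.mem_univ, true_imp_iff, Fin.forall_fin_succ, Fin.cons_zero, Fin.cons_succ,
      Set.mem_prod, Set.mem_pi]
  have hcont : Continuous fun z : ℝ × (Fin n → ℝ) => f (Fin.cons z.1 z.2) :=
    hf.comp (Continuous.finCons continuous_fst continuous_snd)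
  rw [← e.setIntegral_preimage_emb (MeasurableEquiv.measurableEmbedding _), hpre]
  simp only [hcons]
  rw [Measure.volume_eq_prod, ← Measure.prod_restrict, integral_prod_symm]
  · refine integral_congr_ae (Filter.Eventually.of_forall fun y => ?_)
    dsimp only
    rw [integral_Icc_eq_integral_Ioc, ← intervalIntegral.integral_of_le hab]
    exact h y
  · rw [Measure.prod_restrict]
    exact hcont.continuousOn.integrableOn_compact
      (isCompact_Icc.prod (isCompact_univ_pi fun _ => isCompact_Icc))

/-- **Partition function of prelinearized U(1) lattice gauge theory on the hexagon.**
For every real `β`, the integral over `[0,2π]^6` of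
`(1+β sin(θ₁+θ₂))(1+β sin(θ₂+θ₃))(1+β cos(θ₃+θ₄))(1−β sin(θ₄+θ₅))(1−β sin(θ₅+θ₆))(1+β cos(θ₆+θ₁))`
equals `(2π)^6 + 2π^6 β^6`. -/
theorem stmt_0 (β : ℝ) :
    (∫ θ : Fin 6 → ℝ in Set.univ.pi (fun _ => Set.Icc (0:ℝ) (2*π)),
      (1 + β * sin (θ 0 + θ 1)) * (1 + β * sin (θ 1 + θ 2)) *
      (1 + β * cos (θ 2 + θ 3)) * (1 - β * sin (θ 3 + θ 4)) *
      (1 - β * sin (θ 4 + θ 5)) * (1 + β * cos (θ 5 + θ 0)))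
    = (2*π)^6 + 2*π^6*β^6 := by
  have hab : (0:ℝ) ≤ 2*π := by positivity
  rw [setIntegral_box_succ hab (by fun_prop) (g := fun y : Fin 5 → ℝ =>
    (2*π + π*β^2 * sin (y 0 - y 4)) * ((1 + β * sin (y 0 + y 1)) *
      ((1 + β * cos (y 1 + y 2)) * (1 - β * sin (y 2 + y 3)) * (1 - β * sin (y 3 + y 4)))))]
  swap
  · intro y
    change ∫ x in (0:ℝ)..2*π, (1 + β * sin (x + y 0)) * (1 + β * sin (y 0 + y 1)) *
      (1 + β * cos (y 1 + y 2)) * (1 - β * sin (y 2 + y 3)) *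
      (1 - β * sin (y 3 + y 4)) * (1 + β * cos (y 4 + x)) = _
    generalize (1 + β * sin (y 0 + y 1)) = R₁
    generalize (1 + β * cos (y 1 + y 2)) = R₂
    generalize (1 - β * sin (y 2 + y 3)) = R₃
    generalize (1 - β * sin (y 3 + y 4)) = R₄
    trans 2*π*(1*(R₁*R₂*R₃*R₄)) + π*(β * sin (y 0) * (R₁*R₂*R₃*R₄*β*cos (y 4))
      + β * cos (y 0) * (-R₁*R₂*R₃*R₄*β*sin (y 4)))
    · rw [← integral_mul_trig]
      congr 1; ext x; rw [sin_add, cos_add]; ring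
    · rw [sin_sub]; ring
  rw [setIntegral_box_succ hab (by fun_prop) (g := fun y : Fin 4 → ℝ =>
    (4*π^2 + π^2*β^3 * cos (y 0 + y 3)) * ((1 + β * cos (y 0 + y 1)) *
      ((1 - β * sin (y 1 + y 2)) * (1 - β * sin (y 2 + y 3)))))]
  swap
  · intro y
    change ∫ x in (0:ℝ)..2*π, (2*π + π*β^2 * sin (x - y 3)) * ((1 + β * sin (x + y 0)) *
      ((1 + β * cos (y 0 + y 1)) * (1 - β * sin (y 1 + y 2)) * (1 - β * sin (y 2 + y 3)))) = _
    generalize (1 + β * cos (y 0 + y 1)) = R₁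
    generalize (1 - β * sin (y 1 + y 2)) = R₂
    generalize (1 - β * sin (y 2 + y 3)) = R₃
    trans 2*π*(2*π*(R₁*R₂*R₃)) + π*(-π*β^2*sin (y 3) * (R₁*R₂*R₃*β*sin (y 0))
      + π*β^2*cos (y 3) * (R₁*R₂*R₃*β*cos (y 0)))
    · rw [← integral_mul_trig]
      congr 1; ext x; rw [sin_add, sin_sub]; ring
    · rw [cos_add]; ring
  rw [setIntegral_box_succ hab (by fun_prop) (g := fun y : Fin 3 → ℝ =>
    (8*π^3 + π^3*β^4 * cos (y 0 - y 2)) * ((1 - β * sin (y 0 + y 1)) *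
      (1 - β * sin (y 1 + y 2))))]
  swap
  · intro y
    change ∫ x in (0:ℝ)..2*π, (4*π^2 + π^2*β^3 * cos (x + y 2)) * ((1 + β * cos (x + y 0)) *
      ((1 - β * sin (y 0 + y 1)) * (1 - β * sin (y 1 + y 2)))) = _
    generalize (1 - β * sin (y 0 + y 1)) = R₁
    generalize (1 - β * sin (y 1 + y 2)) = R₂
    trans 2*π*(4*π^2*(R₁*R₂)) + π*(π^2*β^3*cos (y 2) * (R₁*R₂*β*cos (y 0))
      + -π^2*β^3*sin (y 2) * (-R₁*R₂*β*sin (y 0)))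
    · rw [← integral_mul_trig]
      congr 1; ext x; rw [cos_add, cos_add]; ring
    · rw [cos_sub]; ring
  rw [setIntegral_box_succ hab (by fun_prop) (g := fun y : Fin 2 → ℝ =>
    (16*π^4 - π^4*β^5 * sin (y 0 + y 1)) * (1 - β * sin (y 0 + y 1)))]
  swap
  · intro y
    change ∫ x in (0:ℝ)..2*π, (8*π^3 + π^3*β^4 * cos (x - y 1)) * ((1 - β * sin (x + y 0)) *
      (1 - β * sin (y 0 + y 1))) = _
    trans 2*π*(8*π^3*(1 - β * sin (y 0 + y 1)))
      + π*(π^3*β^4*cos (y 1) * (-(1 - β * sin (y 0 + y 1))*β*sin (y 0))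
      + π^3*β^4*sin (y 1) * (-(1 - β * sin (y 0 + y 1))*β*cos (y 0)))
    · rw [← integral_mul_trig]
      congr 1; ext x; rw [cos_sub, sin_add x]; ring
    · rw [sin_add]; ring
  rw [setIntegral_box_succ hab (by fun_prop) (g := fun _ : Fin 1 → ℝ => 32*π^5 + π^5*β^6)]
  swap
  · intro y
    change ∫ x in (0:ℝ)..2*π, (16*π^4 - π^4*β^5 * sin (x + y 0)) * (1 - β * sin (x + y 0)) = _
    trans 2*π*(16*π^4*1) + π*(-π^4*β^5*sin (y 0) * (-β*sin (y 0))
      + -π^4*β^5*cos (y 0) * (-β*cos (y 0)))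
    · rw [← integral_mul_trig]
      congr 1; ext x; rw [sin_add]; ring
    · linear_combination π^5*β^6 * sin_sq_add_cos_sq (y 0)
  rw [setIntegral_const, measureReal_def, volume_pi_pi]
  simp [ENNReal.toReal_ofReal pi_pos.le]
  ring
end

section
/- Let f : ℝ^6 → ℝ be integrable on [0,2π]^6 and invariant under each of the transformations replacing one coordinate θₙ (n = 1,…,6) by π+θₙ or by π−θₙ (i.e., for all θ ∈ ℝ^6 and all n, f is unchanged when θₙ is replaced by π+θₙ, and also when θₙ is replaced by π−θₙ). Then for every real β: ∫_{[0,2π]^6} f(θ)·Π_β(θ) dθ = ∫_{[0,2π]^6} f(θ)·(1 + β^6 T₁(θ) + β^6 T₂(θ)) dθ. -/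
open MeasureTheory Real

/-- Exchange of the two halves of `[0, 2π)`, i.e. the half-turn of the circle. -/
noncomputable def halfTurn (x : ℝ) : ℝ := if x < π then π + x else x - π

lemma measurable_halfTurn : Measurable halfTurn :=
  Measurable.ite measurableSet_Iio (by fun_prop) (by fun_prop)

lemma cos_halfTurn (x : ℝ) : cos (halfTurn x) = -cos x := by
  unfold halfTurn; split_ifs
  · rw [add_comm, cos_add_pi]
  · rw [cos_sub_pi]

lemma sin_halfTurn (x : ℝ) : sin (halfTurn x) = -sin x := by
  unfold halfTurn; split_ifs
  · rw [add_comm, sin_add_pi]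
  · rw [sin_sub_pi]

lemma measurePreserving_halfTurn :
    MeasurePreserving halfTurn (volume.restrict (Set.Icc (0 : ℝ) (2 * π)))
      (volume.restrict (Set.Icc (0 : ℝ) (2 * π))) := by
  refine ⟨measurable_halfTurn, ?_⟩
  have hsplit : volume.restrict (Set.Icc (0 : ℝ) (2 * π)) =
      volume.restrict (Set.Ico 0 π) + volume.restrict (Set.Ico π (2 * π)) := by
    rw [← Measure.restrict_union
      (Set.disjoint_left.2 fun x hx hx' => absurd hx.2 (not_lt.2 hx'.1)) measurableSet_Ico,
      Set.Ico_union_Ico_eq_Ico pi_pos.le (by linarith [pi_pos]), restrict_Ico_eq_restrict_Icc]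
  have hleft : (volume.restrict (Set.Ico (0 : ℝ) π)).map halfTurn =
      volume.restrict (Set.Ico π (2 * π)) := by
    have h := (measurePreserving_add_left volume π).restrict_preimage
      (measurableSet_Ico (a := π) (b := 2 * π))
    have hpre : (fun x => π + x) ⁻¹' Set.Ico π (2 * π) = Set.Ico 0 π := by
      ext x; simp only [Set.mem_preimage, Set.mem_Ico]; constructor <;> rintro ⟨_, _⟩ <;>
        constructor <;> linarith
    rw [hpre] at h
    rw [← h.map_eq]
    refine Measure.map_congr ((ae_restrict_iff' measurableSet_Ico).2 (.of_forall fun x hx => ?_))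
    exact if_pos hx.2
  have hright : (volume.restrict (Set.Ico π (2 * π))).map halfTurn =
      volume.restrict (Set.Ico (0 : ℝ) π) := by
    have h := (measurePreserving_sub_right volume π).restrict_preimage
      (measurableSet_Ico (a := 0) (b := π))
    have hpre : (fun x => x - π) ⁻¹' Set.Ico 0 π = Set.Ico π (2 * π) := by
      ext x; simp only [Set.mem_preimage, Set.mem_Ico]; constructor <;> rintro ⟨_, _⟩ <;>
        constructor <;> linarith
    rw [hpre] at h
    rw [← h.map_eq]
    refine Measure.map_congr ((ae_restrict_iff' measurableSet_Ico).2 (.of_forall fun x hx => ?_))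
    exact if_neg (not_lt.2 hx.1)
  rw [hsplit, Measure.map_add _ _ measurable_halfTurn, hleft, hright, add_comm]

lemma measurePreserving_two_pi_sub :
    MeasurePreserving (fun x : ℝ => 2 * π - x) (volume.restrict (Set.Icc (0 : ℝ) (2 * π)))
      (volume.restrict (Set.Icc (0 : ℝ) (2 * π))) := by
  have h := (Measure.measurePreserving_sub_left volume (2 * π)).restrict_preimage
    (measurableSet_Icc (a := 0) (b := 2 * π))
  rwa [Set.preimage_const_sub_Icc, sub_self, sub_zero] at h

section Cube

variable {ι : Type*} [Fintype ι]

/-- The cube `[0, 2π]^ι`. -/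
abbrev angleCube (ι : Type*) : Set (ι → ℝ) := Set.univ.pi fun _ => Set.Icc (0 : ℝ) (2 * π)

lemma integrableOn_angleCube_mul {f g : (ι → ℝ) → ℝ} (hf : IntegrableOn f (angleCube ι))
    (hg : Continuous g) : IntegrableOn (fun θ => f θ * g θ) (angleCube ι) :=
  hf.mul_continuousOn hg.continuousOn (isCompact_univ_pi fun _ => isCompact_Icc)

variable [DecidableEq ι]

/-- A function that is odd under a measure-preserving change of one angle integrates to zero. -/
lemma setIntegral_angleCube_eq_zero_of_odd {n : ι} {φ : ℝ → ℝ}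
    (hφ : MeasurePreserving φ (volume.restrict (Set.Icc (0 : ℝ) (2 * π)))
      (volume.restrict (Set.Icc (0 : ℝ) (2 * π))))
    {g : (ι → ℝ) → ℝ} (hg : IntegrableOn g (angleCube ι))
    (hodd : ∀ θ, g (Function.update θ n (φ (θ n))) = -g θ) :
    ∫ θ in angleCube ι, g θ = 0 := by
  have hpres : MeasurePreserving (fun θ : ι → ℝ => Function.update θ n (φ (θ n)))
      (volume.restrict (angleCube ι)) (volume.restrict (angleCube ι)) := by
    rw [volume_pi, Measure.restrict_pi_pi]
    have h := measurePreserving_pi (fun _ : ι => volume.restrict (Set.Icc (0 : ℝ) (2 * π)))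
      (fun _ : ι => volume.restrict (Set.Icc (0 : ℝ) (2 * π)))
      (f := fun i => if i = n then φ else id)
      (fun i => by split_ifs; exacts [hφ, MeasurePreserving.id _])
    have hfun : (fun θ : ι → ℝ => Function.update θ n (φ (θ n))) =
        fun θ i => (if i = n then φ else id) (θ i) := by
      funext θ i
      by_cases hi : i = n
      · subst hi; simp
      · simp [hi]
    rw [hfun]
    exact h
  have h := integral_map hpres.aemeasurable (f := g) (by
    rw [hpres.map_eq]; exact hg.aestronglyMeasurable)
  rw [hpres.map_eq] at h
  simp only [hodd, integral_neg] at h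
  linarith

/-- Integrating out the angle `θ n` when `f` is invariant under `θ n ↦ π + θ n` and
`θ n ↦ π - θ n`: only the monomials even in both `cos (θ n)` and `sin (θ n)` survive. -/
lemma setIntegral_angleCube_mul_transfer {f : (ι → ℝ) → ℝ} (hf : IntegrableOn f (angleCube ι))
    (n : ι) (hf_plus : ∀ θ, f (Function.update θ n (π + θ n)) = f θ)
    (hf_minus : ∀ θ, f (Function.update θ n (π - θ n)) = f θ)
    (A B C D E : (ι → ℝ) → ℝ) (hA : Continuous A) (hB : Continuous B) (hC : Continuous C)
    (hD : Continuous D) (hE : Continuous E)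
    (hA' : ∀ θ x, A (Function.update θ n x) = A θ) (hB' : ∀ θ x, B (Function.update θ n x) = B θ)
    (hC' : ∀ θ x, C (Function.update θ n x) = C θ) (hD' : ∀ θ x, D (Function.update θ n x) = D θ)
    (hE' : ∀ θ x, E (Function.update θ n x) = E θ) :
    ∫ θ in angleCube ι, f θ * ((1 + (A θ * cos (θ n) + B θ * sin (θ n))) *
        (1 + (C θ * cos (θ n) + D θ * sin (θ n))) * E θ) =
      ∫ θ in angleCube ι,
        f θ * ((1 + (A θ * C θ * cos (θ n) ^ 2 + B θ * D θ * sin (θ n) ^ 2)) * E θ) := by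
  have hf_halfTurn : ∀ θ, f (Function.update θ n (halfTurn (θ n))) = f θ := by
    intro θ
    unfold halfTurn; split_ifs
    · exact hf_plus θ
    · simpa using (hf_plus (Function.update θ n (θ n - π))).symm
  have hf_refl : ∀ θ, f (Function.update θ n (2 * π - θ n)) = f θ := by
    intro θ
    rw [← hf_minus θ, ← hf_plus (Function.update θ n (π - θ n)), Function.update_idem,
      Function.update_self]
    ring_nf
  have hlin : IntegrableOn (fun θ => f θ * (((A θ + C θ) * cos (θ n) + (B θ + D θ) * sin (θ n)) *
      E θ)) (angleCube ι) := integrableOn_angleCube_mul hf (by fun_prop)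
  have hmix : IntegrableOn (fun θ => f θ * ((A θ * D θ + B θ * C θ) * (cos (θ n) * sin (θ n)) *
      E θ)) (angleCube ι) := integrableOn_angleCube_mul hf (by fun_prop)
  have hlin0 := setIntegral_angleCube_eq_zero_of_odd measurePreserving_halfTurn hlin (n := n)
    fun θ => by
      simp only [hf_halfTurn, hA', hB', hC', hD', hE', Function.update_self, cos_halfTurn,
        sin_halfTurn]
      ring
  have hmix0 := setIntegral_angleCube_eq_zero_of_odd measurePreserving_two_pi_sub hmix (n := n)
    fun θ => by
      simp only [hf_refl, hA', hB', hC', hD', hE', Function.update_self, cos_two_pi_sub,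
        sin_two_pi_sub]
      ring
  have heven : IntegrableOn (fun θ => f θ * ((1 + (A θ * C θ * cos (θ n) ^ 2 +
      B θ * D θ * sin (θ n) ^ 2)) * E θ)) (angleCube ι) :=
    integrableOn_angleCube_mul hf (by fun_prop)
  have hsum := integral_add (heven.add hlin) hmix
  simp only [Pi.add_apply] at hsum
  rw [integral_add heven hlin, hlin0, hmix0, add_zero, add_zero] at hsum
  rw [← hsum]
  congr 1 with θ
  ring

end Cube

/-- **Linearization identity for prelinearized U(1) gauge theory on the hexagon.**
If `f : ℝ^6 → ℝ` is integrable on `[0,2π]^6` and invariant under replacing any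
coordinate `θₙ` by `π + θₙ` or by `π − θₙ`, then the expectation of `f` against the
prelinearized density equals its expectation against the linearized density
`1 + β⁶ T₁ + β⁶ T₂`. -/
theorem stmt_1 (f : (Fin 6 → ℝ) → ℝ)
    (hf_int : IntegrableOn f (Set.univ.pi (fun _ => Set.Icc (0:ℝ) (2*π))) volume)
    (hf_plus : ∀ (θ : Fin 6 → ℝ) (n : Fin 6),
      f (Function.update θ n (π + θ n)) = f θ)
    (hf_minus : ∀ (θ : Fin 6 → ℝ) (n : Fin 6),
      f (Function.update θ n (π - θ n)) = f θ)
    (β : ℝ) :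
    (∫ θ : Fin 6 → ℝ in Set.univ.pi (fun _ => Set.Icc (0:ℝ) (2*π)),
      f θ * ((1 + β * sin (θ 0 + θ 1)) * (1 + β * sin (θ 1 + θ 2)) *
        (1 + β * cos (θ 2 + θ 3)) * (1 - β * sin (θ 3 + θ 4)) *
        (1 - β * sin (θ 4 + θ 5)) * (1 + β * cos (θ 5 + θ 0))))
    = ∫ θ : Fin 6 → ℝ in Set.univ.pi (fun _ => Set.Icc (0:ℝ) (2*π)),
      f θ * (1
        + β^6 * (cos (θ 0)^2 * sin (θ 1)^2 * cos (θ 2)^2 *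
                 cos (θ 3)^2 * sin (θ 4)^2 * cos (θ 5)^2)
        + β^6 * (sin (θ 0)^2 * cos (θ 1)^2 * sin (θ 2)^2 *
                 sin (θ 3)^2 * cos (θ 4)^2 * sin (θ 5)^2)) := by
  have transfer := fun n => setIntegral_angleCube_mul_transfer hf_int n
    (fun θ => hf_plus θ n) (fun θ => hf_minus θ n)
  have h₁ := transfer 1 (fun θ => β * sin (θ 0)) (fun θ => β * cos (θ 0))
    (fun θ => β * sin (θ 2)) (fun θ => β * cos (θ 2))
    (fun θ => (1 + β * cos (θ 2 + θ 3)) * (1 - β * sin (θ 3 + θ 4)) *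
      (1 - β * sin (θ 4 + θ 5)) * (1 + β * cos (θ 5 + θ 0)))
    (by fun_prop) (by fun_prop) (by fun_prop) (by fun_prop) (by fun_prop)
    (by simp) (by simp) (by simp) (by simp) (by simp)
  have h₂ := transfer 2 (fun θ => β ^ 2 * (cos (θ 0) * sin (θ 1) ^ 2))
    (fun θ => β ^ 2 * (sin (θ 0) * cos (θ 1) ^ 2))
    (fun θ => β * cos (θ 3)) (fun θ => -(β * sin (θ 3)))
    (fun θ => (1 - β * sin (θ 3 + θ 4)) * (1 - β * sin (θ 4 + θ 5)) * (1 + β * cos (θ 5 + θ 0)))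
    (by fun_prop) (by fun_prop) (by fun_prop) (by fun_prop) (by fun_prop)
    (by simp) (by simp) (by simp) (by simp) (by simp)
  have h₃ := transfer 3 (fun θ => β ^ 3 * (cos (θ 0) * sin (θ 1) ^ 2 * cos (θ 2) ^ 2))
    (fun θ => -(β ^ 3 * (sin (θ 0) * cos (θ 1) ^ 2 * sin (θ 2) ^ 2)))
    (fun θ => -(β * sin (θ 4))) (fun θ => -(β * cos (θ 4)))
    (fun θ => (1 - β * sin (θ 4 + θ 5)) * (1 + β * cos (θ 5 + θ 0)))
    (by fun_prop) (by fun_prop) (by fun_prop) (by fun_prop) (by fun_prop)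
    (by simp) (by simp) (by simp) (by simp) (by simp)
  have h₄ := transfer 4
    (fun θ => β ^ 4 * (sin (θ 0) * cos (θ 1) ^ 2 * sin (θ 2) ^ 2 * sin (θ 3) ^ 2))
    (fun θ => -(β ^ 4 * (cos (θ 0) * sin (θ 1) ^ 2 * cos (θ 2) ^ 2 * cos (θ 3) ^ 2)))
    (fun θ => -(β * sin (θ 5))) (fun θ => -(β * cos (θ 5)))
    (fun θ => 1 + β * cos (θ 5 + θ 0))
    (by fun_prop) (by fun_prop) (by fun_prop) (by fun_prop) (by fun_prop)
    (by simp) (by simp) (by simp) (by simp) (by simp)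
  have h₅ := transfer 5
    (fun θ => β ^ 5 * (cos (θ 0) * sin (θ 1) ^ 2 * cos (θ 2) ^ 2 * cos (θ 3) ^ 2 * sin (θ 4) ^ 2))
    (fun θ => -(β ^ 5 *
      (sin (θ 0) * cos (θ 1) ^ 2 * sin (θ 2) ^ 2 * sin (θ 3) ^ 2 * cos (θ 4) ^ 2)))
    (fun θ => β * cos (θ 0)) (fun θ => -(β * sin (θ 0))) (fun _ => 1)
    (by fun_prop) (by fun_prop) (by fun_prop) (by fun_prop) (by fun_prop)
    (by simp) (by simp) (by simp) (by simp) (by simp)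
  refine Eq.trans ?_ (h₁.trans (Eq.trans ?_ (h₂.trans (Eq.trans ?_ (h₃.trans (Eq.trans ?_
    (h₄.trans (Eq.trans ?_ (h₅.trans ?_)))))))))
  · congr 1 with θ
    rw [sin_add (θ 0), sin_add (θ 1)]
    ring
  · congr 1 with θ
    rw [cos_add (θ 2)]
    ring
  · congr 1 with θ
    rw [sin_add (θ 3)]
    ring
  · congr 1 with θ
    rw [sin_add (θ 4)]
    ring
  · congr 1 with θ
    rw [cos_add (θ 5)]
    ring
  · congr 1 with θ
    ring
end

section
/- Let V, B, E be finite types, a, b : E → V ⊕ B, and σ : B → Bool. For every spin configuration Σ : V → Bool, the integral over [0,2π]^E (product Lebesgue measure on functions θ : E → ℝ with each coordinate in [0,2π]) of the weight P(θ,Σ) = ∏_{e ∈ E} (cos²(θ(e)) if Σ̂(a(e)) = Σ̂(b(e)), and sin²(θ(e)) otherwise), where Σ̂ = Sum.elim Σ σ, equals π^{card E}. In particular this integral is the same for all Σ. -/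
open MeasureTheory Real

/-- **Constancy of the partition function of the random-medium Ising model.**
For a graph with nonboundary vertices `V`, boundary vertices `B`, nonboundary
edges `E` (with endpoint maps `a b : E → V ⊕ B`) and boundary condition
`σ : B → Bool`, for every spin configuration `Spin : V → Bool` the integral over
`[0,2π]^E` of the weight `P(θ,Spin)` equals `π ^ card E`; in particular it does
not depend on `Spin`. -/
theorem stmt_3 (V B E : Type) [Fintype V] [Fintype B] [Fintype E]
    (a b : E → V ⊕ B) (σ : B → Bool) (Spin : V → Bool) :
    (∫ θ : E → ℝ in Set.univ.pi (fun _ => Set.Icc (0:ℝ) (2*π)),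
      ∏ e : E,
        (if Sum.elim Spin σ (a e) = Sum.elim Spin σ (b e)
          then cos (θ e)^2 else sin (θ e)^2))
    = π ^ (Fintype.card E) := by
  rw [volume_pi, Measure.restrict_pi_pi,
    integral_fintype_prod_eq_prod (fun (e : E) (x : ℝ) =>
      if Sum.elim Spin σ (a e) = Sum.elim Spin σ (b e) then cos x ^ 2 else sin x ^ 2),
    ← Finset.card_univ]
  refine Finset.prod_eq_pow_card fun e _ => ?_
  rw [integral_Icc_eq_integral_Ioc, ← intervalIntegral.integral_of_le two_pi_pos.le]
  split_ifs
  · simp [integral_cos_sq]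
  · simp [integral_sin_sq]
end

section
/- Let V, B, E be finite types, a, b : E → V ⊕ B, and σ : B → Bool, and for Σ : V → Bool and θ : E → ℝ let P(θ,Σ) = ∏_{e ∈ E} (cos²(θ(e)) if Σ̂(a(e)) = Σ̂(b(e)), and sin²(θ(e)) otherwise), where Σ̂ = Sum.elim Σ σ. Then for every function f : (V → Bool) → ℝ (with the convention 0/0 = 0): ∫_{[0,2π]^E} [ (Σ_{Σ : V→Bool} f(Σ) P(θ,Σ)) / (Σ_{Σ : V→Bool} P(θ,Σ)) ] · (Σ_{Σ : V→Bool} P(θ,Σ)) / (2^{card V} · π^{card E}) dθ = 2^{−card V} · Σ_{Σ : V→Bool} f(Σ). That is, the conditional-expectation observable E(f∘p₂ | p₁) in linearized gauge theory has the same expectation as f in the uniform percolation model on spin configurations. -/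
open MeasureTheory Real

/-- If the weights are nonnegative, a weighted average times the total weight is the weighted sum,
even when the total weight vanishes and the average is read as `0 / 0 = 0`. -/
theorem weighted_sum_div_mul_cancel {ι : Type*} [Fintype ι] (f p : ι → ℝ) (hp : ∀ i, 0 ≤ p i)
    (c : ℝ) :
    (∑ i, f i * p i) / (∑ i, p i) * ((∑ i, p i) / c) = (∑ i, f i * p i) / c := by
  by_cases h : ∑ i, p i = 0
  · have h_zero : ∀ i, p i = 0 := fun i =>
      (Finset.sum_eq_zero_iff_of_nonneg fun i _ => hp i).1 h i (Finset.mem_univ i)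
    simp [h_zero]
  · field_simp

theorem continuous_ite_cos_sq_sin_sq (q : Prop) [Decidable q] :
    Continuous fun x : ℝ => if q then cos x ^ 2 else sin x ^ 2 := by
  split_ifs <;> fun_prop

theorem setIntegral_ite_cos_sq_sin_sq (q : Prop) [Decidable q] :
    ∫ x in Set.Icc (0 : ℝ) (2 * π), (if q then cos x ^ 2 else sin x ^ 2) = π := by
  rw [integral_Icc_eq_integral_Ioc, ← intervalIntegral.integral_of_le (by positivity)]
  split_ifs
  · simp [integral_cos_sq]
  · simp [integral_sin_sq]

theorem setIntegral_pi_prod_ite_cos_sq_sin_sq {E : Type*} [Fintype E] (q : E → Prop)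
    [DecidablePred q] :
    ∫ θ : E → ℝ in Set.univ.pi (fun _ => Set.Icc (0 : ℝ) (2 * π)),
      ∏ e, (if q e then cos (θ e) ^ 2 else sin (θ e) ^ 2) = π ^ Fintype.card E := by
  rw [volume_pi, Measure.restrict_pi_pi,
    integral_fintype_prod_eq_prod (fun e x => if q e then cos x ^ 2 else sin x ^ 2)]
  simp [setIntegral_ite_cos_sq_sin_sq]

theorem integrableOn_pi_prod_ite_cos_sq_sin_sq {E : Type*} [Fintype E] (q : E → Prop)
    [DecidablePred q] :
    IntegrableOn (fun θ : E → ℝ => ∏ e, (if q e then cos (θ e) ^ 2 else sin (θ e) ^ 2))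
      (Set.univ.pi fun _ => Set.Icc (0 : ℝ) (2 * π)) := by
  refine ContinuousOn.integrableOn_compact (isCompact_univ_pi fun _ => isCompact_Icc)
    (Continuous.continuousOn ?_)
  exact continuous_finsetProd _ fun e _ =>
    (continuous_ite_cos_sq_sin_sq (q e)).comp (continuous_apply e)

/-- **The conditional-expectation observable in linearized U(1) gauge theory has the
same expectation as the original observable in the percolation model.**
With `P(θ,S) = ∏ₑ (cos²θ(e)` if the endpoint spins of `e` agree, `sin²θ(e)` otherwise)`,
for every `f : (V → Bool) → ℝ` (convention `0/0 = 0`, Lean's division):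
`∫_{[0,2π]^E} [(∑_S f(S)P(θ,S))/(∑_S P(θ,S))] · (∑_S P(θ,S))/(2^{|V|}π^{|E|}) dθ
  = 2^{−|V|} ∑_S f(S)`. -/
theorem stmt_4 (V B E : Type) [Fintype V] [DecidableEq V] [Fintype B] [Fintype E]
    (a b : E → V ⊕ B) (σ : B → Bool) (f : (V → Bool) → ℝ) :
    (∫ θ : E → ℝ in Set.univ.pi (fun _ => Set.Icc (0:ℝ) (2*π)),
      ((∑ Spin : V → Bool, f Spin *
          ∏ e : E, (if Sum.elim Spin σ (a e) = Sum.elim Spin σ (b e)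
            then cos (θ e)^2 else sin (θ e)^2)) /
        (∑ Spin : V → Bool,
          ∏ e : E, (if Sum.elim Spin σ (a e) = Sum.elim Spin σ (b e)
            then cos (θ e)^2 else sin (θ e)^2))) *
      ((∑ Spin : V → Bool,
          ∏ e : E, (if Sum.elim Spin σ (a e) = Sum.elim Spin σ (b e)
            then cos (θ e)^2 else sin (θ e)^2)) /
        (2 ^ (Fintype.card V) * π ^ (Fintype.card E))))
    = (2 ^ (Fintype.card V) : ℝ)⁻¹ * ∑ Spin : V → Bool, f Spin := by
  have h_nonneg : ∀ (θ : E → ℝ) (S : V → Bool),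
      0 ≤ ∏ e : E, (if Sum.elim S σ (a e) = Sum.elim S σ (b e)
        then cos (θ e) ^ 2 else sin (θ e) ^ 2) := fun θ S =>
    Finset.prod_nonneg fun e _ => by split_ifs <;> positivity
  simp_rw [fun θ => weighted_sum_div_mul_cancel f _ (h_nonneg θ)]
  rw [integral_div, integral_finsetSum _ fun S _ =>
    (integrableOn_pi_prod_ite_cos_sq_sin_sq _).const_mul (f S)]
  simp_rw [integral_const_mul, setIntegral_pi_prod_ite_cos_sq_sin_sq, ← Finset.sum_mul]
  field_simp
end

section
/- Let n ≥ 1 and let h, U : ZMod n → ℍ be functions into the quaternions with ‖h(m)‖ = 1 and ‖U(m)‖ = 1 for all m. Define F(m) = U(m) · (h(m) · star(h(m+1))) · star(U(m+1)) for each m ∈ ZMod n, and suppose F(m) ∈ {1, −1} (as quaternions) for every m. Then ∏_{m ∈ ZMod n} re(F(m)) = 1 (product of real numbers). -/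
open Quaternion

/-- If `c m = r m * c (m + 1)` around a cycle and `c` is nonzero somewhere, then the product of
the ratios `r` is `1`. -/
theorem ZMod.prod_eq_one_of_eq_mul_succ {K : Type*} [Field K] (n : ℕ) [NeZero n]
    (r c : ZMod n → K) (hc : ∀ m, c m = r m * c (m + 1)) (h0 : c 0 ≠ 0) :
    ∏ m, r m = 1 := by
  have hnat : ∀ k : ℕ, c (k : ZMod n) ≠ 0 := by
    intro k
    induction k with
    | zero => simpa using h0
    | succ k ih =>
      rw [hc] at ih
      simpa using right_ne_zero_of_mul ih
  have hprod : ∏ m, c m ≠ 0 := Finset.prod_ne_zero_iff.mpr fun m _ => by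
    simpa using hnat m.val
  have hshift : ∏ m, c (m + 1) = ∏ m, c m := Equiv.prod_comp (Equiv.addRight (1 : ZMod n)) c
  have hmul : ∏ m, c m = (∏ m, r m) * ∏ m, c m := by
    conv_lhs => rw [Finset.prod_congr rfl fun m _ => hc m]
    rw [Finset.prod_mul_distrib, hshift]
  exact (mul_eq_right₀ hprod).mp hmul.symm

/-- If `a * star b` is `1` or `-1` for a unit quaternion `b`, then `a` is the real multiple of `b`
by the real part of `a * star b`. -/
theorem Quaternion.eq_re_smul_of_mul_star_eq (a b : ℍ[ℝ]) (hb : ‖b‖ = 1)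
    (hab : a * star b = 1 ∨ a * star b = -1) : a = (a * star b).re • b := by
  have hbb : star b * b = 1 := by
    rw [Quaternion.star_mul_self, Quaternion.normSq_eq_norm_mul_self, hb]
    simp
  have ha : a = a * star b * b := by rw [mul_assoc, hbb, mul_one]
  rcases hab with h | h <;> rw [h] at ha ⊢ <;> simpa using ha

/-- **Penrose-type sign lemma on the fan triangulation.** Let `n ≥ 1` (expressed
via `[NeZero n]`) and `h U : ZMod n → ℍ` be unit quaternions. If each face value
`F(m) = U(m)·(h(m)·star h(m+1))·star U(m+1)` equals `1` or `−1`, then the product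
of the real parts `re F(m)` over all faces equals `1`. -/
theorem stmt_6 (n : ℕ) [NeZero n] (h U : ZMod n → ℍ[ℝ])
    (hh : ∀ m : ZMod n, ‖h m‖ = 1) (hU : ∀ m : ZMod n, ‖U m‖ = 1)
    (hF : ∀ m : ZMod n,
      U m * (h m * star (h (m + 1))) * star (U (m + 1)) = 1 ∨
      U m * (h m * star (h (m + 1))) * star (U (m + 1)) = -1) :
    (∏ m : ZMod n, (U m * (h m * star (h (m + 1))) * star (U (m + 1))).re) = 1 := by
  have hface : ∀ m, U m * (h m * star (h (m + 1))) * star (U (m + 1)) =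
      (U m * h m) * star (U (m + 1) * h (m + 1)) := fun m => by
    rw [star_mul]
    simp only [mul_assoc]
  have hnorm : ∀ m, ‖U m * h m‖ = 1 := fun m => by rw [norm_mul, hU, hh, one_mul]
  simp only [hface] at hF ⊢
  refine ZMod.prod_eq_one_of_eq_mul_succ n _
    (fun m => (U m * h m * star (U 0 * h 0)).re) (fun m => ?_) ?_
  · conv_lhs => rw [Quaternion.eq_re_smul_of_mul_star_eq _ _ (hnorm (m + 1)) (hF m)]
    rw [smul_mul_assoc, Quaternion.re_smul, smul_eq_mul]
  · rw [Quaternion.self_mul_star, Quaternion.normSq_eq_norm_mul_self, hnorm]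
    simp
end

section
/- Let n ≥ 1, let Q = {1, i, j, k} ⊂ ℍ be the set of basis quaternion units, and let h, u : ZMod n → Q. Suppose that for every m ∈ ZMod n the quaternion u(m) · (h(m) · star(h(m+1))) · star(u(m+1)) lies in {1, −1}. Then there exists a unique q ∈ Q such that for every m ∈ ZMod n, u(m) · h(m) ∈ {q, −q}. -/
open Quaternion

/-- The quaternion unit `i`. -/
def qi : ℍ[ℝ] := ⟨0, 1, 0, 0⟩
/-- The quaternion unit `j`. -/
def qj : ℍ[ℝ] := ⟨0, 0, 1, 0⟩
/-- The quaternion unit `k`. -/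
def qk : ℍ[ℝ] := ⟨0, 0, 0, 1⟩

theorem qi_components : qi.re = 0 ∧ qi.imI = 1 ∧ qi.imJ = 0 ∧ qi.imK = 0 :=
  ⟨rfl, rfl, rfl, rfl⟩

theorem qj_components : qj.re = 0 ∧ qj.imI = 0 ∧ qj.imJ = 1 ∧ qj.imK = 0 :=
  ⟨rfl, rfl, rfl, rfl⟩

theorem qk_components : qk.re = 0 ∧ qk.imI = 0 ∧ qk.imJ = 0 ∧ qk.imK = 1 :=
  ⟨rfl, rfl, rfl, rfl⟩

theorem exists_mul_mem_pm {a b : ℍ[ℝ]} (ha : a ∈ ({1, qi, qj, qk} : Set ℍ[ℝ]))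
    (hb : b ∈ ({1, qi, qj, qk} : Set ℍ[ℝ])) :
    ∃ q ∈ ({1, qi, qj, qk} : Set ℍ[ℝ]), a * b ∈ ({q, -q} : Set ℍ[ℝ]) := by
  simp only [Set.mem_insert_iff, Set.mem_singleton_iff, exists_eq_or_imp, exists_eq_left] at *
  rcases ha with rfl | rfl | rfl | rfl <;> rcases hb with rfl | rfl | rfl | rfl <;>
    simp [Quaternion.ext_iff, qi_components, qj_components, qk_components]

theorem eq_of_mem_pm {x p q : ℍ[ℝ]} (hp : p ∈ ({1, qi, qj, qk} : Set ℍ[ℝ]))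
    (hq : q ∈ ({1, qi, qj, qk} : Set ℍ[ℝ])) (hxp : x ∈ ({p, -p} : Set ℍ[ℝ]))
    (hxq : x ∈ ({q, -q} : Set ℍ[ℝ])) : p = q := by
  have hpq : p = q ∨ p = -q := by
    rcases hxp with rfl | rfl <;> rcases hxq with h | h <;> simp_all [neg_eq_iff_eq_neg]
  refine hpq.elim id fun hneg => ?_
  rcases hp with rfl | rfl | rfl | rfl <;> rcases hq with rfl | rfl | rfl | rfl <;>
    norm_num [Quaternion.ext_iff, qi_components, qj_components, qk_components] at hneg

theorem star_mul_self_of_mem_basis {a : ℍ[ℝ]} (ha : a ∈ ({1, qi, qj, qk} : Set ℍ[ℝ])) :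
    star a * a = 1 := by
  rcases ha with rfl | rfl | rfl | rfl <;>
    simp [Quaternion.ext_iff, qi_components, qj_components, qk_components]

theorem mem_pm_of_mul_star_mem_pm_one {R : Type*} [Ring R] [StarRing R] {x y q : R}
    (hy : star y * y = 1) (hxy : x * star y ∈ ({1, -1} : Set R))
    (hx : x ∈ ({q, -q} : Set R)) : y ∈ ({q, -q} : Set R) := by
  have hxy' : x = x * star y * y := by rw [mul_assoc, hy, mul_one]
  rcases hxy with h | h <;> rw [h] at hxy' <;> rcases hx with rfl | rfl <;>
    simp_all [neg_eq_iff_eq_neg]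

/-- **Cocycle-is-a-coboundary step on the fan triangulation.** Let `n ≥ 1`
(expressed via `[NeZero n]`), let `Q = {1,i,j,k}` be the basis quaternion units
and `h u : ZMod n → Q`. If `u(m)·(h(m)·star h(m+1))·star u(m+1) ∈ {1,−1}` for
every `m`, then there is a unique `q ∈ Q` with `u(m)·h(m) ∈ {q,−q}` for all `m`. -/
theorem stmt_7 (n : ℕ) [NeZero n] (h u : ZMod n → ℍ[ℝ])
    (hh : ∀ m : ZMod n, h m ∈ ({1, qi, qj, qk} : Set ℍ[ℝ]))
    (hu : ∀ m : ZMod n, u m ∈ ({1, qi, qj, qk} : Set ℍ[ℝ]))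
    (hF : ∀ m : ZMod n,
      u m * (h m * star (h (m + 1))) * star (u (m + 1)) ∈ ({1, -1} : Set ℍ[ℝ])) :
    ∃! q : ℍ[ℝ], q ∈ ({1, qi, qj, qk} : Set ℍ[ℝ]) ∧
      ∀ m : ZMod n, u m * h m ∈ ({q, -q} : Set ℍ[ℝ]) := by
  obtain ⟨q, hq, h0⟩ := exists_mul_mem_pm (hu 0) (hh 0)
  refine ⟨q, ⟨hq, fun m => ?_⟩, fun p hp => eq_of_mem_pm hp.1 hq (hp.2 0) h0⟩
  obtain ⟨k, rfl⟩ := ZMod.natCast_zmod_surjective m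
  induction k with
  | zero => simpa using h0
  | succ k ih =>
    rw [Nat.cast_succ]
    refine mem_pm_of_mul_star_mem_pm_one ?_ ?_ ih
    · rw [star_mul, mul_assoc, ← mul_assoc (star (u _)), star_mul_self_of_mem_basis (hu _),
        one_mul, star_mul_self_of_mem_basis (hh _)]
    · simpa only [star_mul, mul_assoc] using hF k
end

section
/- Define T₁(θ) = cos²θ₁ sin²θ₂ cos²θ₃ cos²θ₄ sin²θ₅ cos²θ₆, T₂(θ) = sin²θ₁ cos²θ₂ sin²θ₃ sin²θ₄ cos²θ₅ sin²θ₆, and D(θ,η) = T₁(θ₁−η, θ₂+η, θ₃−η, θ₄+η, θ₅−η, θ₆+η). Let f : ℝ^6 × ℝ → ℝ be 2π-periodic in each of its 7 arguments, integrable on [0,2π]^7, and gauge-invariant in the sense that f(θ₁+α, θ₂−α, θ₃+α, θ₄−α, θ₅+α, θ₆−α, η+α) = f(θ,η) for all θ ∈ ℝ^6 and α, η ∈ ℝ. Then (1/(2π^6)) · [ ∫_{[0,2π]^6} f(θ,0)·T₁(θ) dθ + ∫_{[0,2π]^6} f(θ,π/2)·T₂(θ) dθ ] = (1/(2π·π^6))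 · ∫_{[0,2π]^7} f(θ,η)·D(θ,η) dθ dη. -/
open MeasureTheory Real

section PeriodicBox

variable {ι E : Type*} [Fintype ι] [DecidableEq ι] {T : ℝ}

/-- The basis of `ι → ℝ` whose vectors are `T` times the standard ones. -/
noncomputable def scaledBasis (ι : Type*) [Fintype ι] [DecidableEq ι] (hT : 0 < T) :
    Module.Basis ι ℝ (ι → ℝ) :=
  (Pi.basisFun ℝ ι).isUnitSMul (w := fun _ => T) fun _ => hT.ne'.isUnit

lemma scaledBasis_apply (hT : 0 < T) (i : ι) : scaledBasis ι hT i = Pi.single i T := by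
  simp [scaledBasis, Module.Basis.isUnitSMul_apply, ← Pi.single_smul]

lemma fundamentalDomain_scaledBasis (hT : 0 < T) :
    ZSpan.fundamentalDomain (scaledBasis ι hT) = Set.univ.pi fun _ => Set.Ico 0 T := by
  ext x
  simp only [ZSpan.mem_fundamentalDomain, Set.mem_pi, Set.mem_univ, true_imp_iff]
  refine forall_congr' fun i => ?_
  rw [scaledBasis, Module.Basis.repr_isUnitSMul]
  simp [Units.smul_def, inv_mul_lt_iff₀ hT, hT]

lemma apply_add_of_mem_span {G : (ι → ℝ) → E} (hT : 0 < T)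
    (hG : ∀ x i, G (Function.update x i (x i + T)) = G x) {v : ι → ℝ}
    (hv : v ∈ Submodule.span ℤ (Set.range (scaledBasis ι hT))) (x : ι → ℝ) :
    G (v + x) = G x := by
  induction hv using Submodule.span_induction generalizing x with
  | mem v hv =>
    obtain ⟨i, rfl⟩ := hv
    rw [← hG x i, scaledBasis_apply]
    congr 1
    ext j
    by_cases h : j = i
    · subst h; simp [add_comm]
    · simp [h]
  | zero => simp
  | add v w _ _ hv hw => rw [add_assoc, hv, hw]
  | smul n v _ hv =>
    have hper : Function.Periodic G v := fun x => by rw [add_comm, hv]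
    rw [add_comm]
    exact hper.zsmul n x

/-- The integral over a period box of a function periodic in each coordinate is invariant under
translation of its argument. -/
lemma setIntegral_pi_Icc_comp_add [NormedAddCommGroup E] [NormedSpace ℝ E] {G : (ι → ℝ) → E}
    (hT : 0 < T) (hG : ∀ x i, G (Function.update x i (x i + T)) = G x) (c : ι → ℝ) :
    ∫ x in Set.univ.pi (fun _ => Set.Icc 0 T), G (c + x)
      = ∫ x in Set.univ.pi (fun _ => Set.Icc 0 T), G x := by
  have hae : (Set.univ.pi fun _ : ι => Set.Ico 0 T)
      =ᵐ[volume] Set.univ.pi fun _ : ι => Set.Icc 0 T :=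
    Measure.pi_Ico_ae_eq_pi_Icc
  rw [← setIntegral_congr_set hae, ← setIntegral_congr_set hae, ← fundamentalDomain_scaledBasis hT,
    ← (measurePreserving_add_left volume c).setIntegral_image_emb
      (measurableEmbedding_addLeft c)]
  have : VAddInvariantMeasure (Submodule.span ℤ (Set.range (scaledBasis ι hT))) (ι → ℝ) volume :=
    ⟨fun v s _ => measure_preimage_add volume (v : ι → ℝ) s⟩
  have hF := ZSpan.isAddFundamentalDomain (scaledBasis ι hT) volume
  exact (hF.vadd_of_comm c).setIntegral_eq hF fun v x => apply_add_of_mem_span hT hG v.2 x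

end PeriodicBox

/-- The linearized Higgs weight of the hexagon for `H(O) = 1`. -/
noncomputable def hexagonWeight (θ : Fin 6 → ℝ) : ℝ :=
  cos (θ 0)^2 * sin (θ 1)^2 * cos (θ 2)^2 * cos (θ 3)^2 * sin (θ 4)^2 * cos (θ 5)^2

/-- The shift of the spoke angles under the gauge transformation by `η` at the centre. -/
def gaugeShift (η : ℝ) (n : Fin 6) : ℝ := if (n : ℕ) % 2 = 0 then η else -η

lemma continuous_hexagonWeight : Continuous hexagonWeight := by
  unfold hexagonWeight
  fun_prop

lemma continuous_gaugeShift : Continuous gaugeShift := by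
  refine continuous_pi fun n => ?_
  unfold gaugeShift
  split_ifs <;> fun_prop

lemma norm_hexagonWeight_le (θ : Fin 6 → ℝ) : ‖hexagonWeight θ‖ ≤ 1 := by
  have hc (x : ℝ) : |cos x| ^ 2 ≤ 1 := by rw [sq_abs]; exact cos_sq_le_one x
  have hs (x : ℝ) : |sin x| ^ 2 ≤ 1 := by rw [sq_abs]; exact sin_sq_le_one x
  simp only [hexagonWeight, norm_mul, norm_pow, norm_eq_abs]
  exact mul_le_one₀ (mul_le_one₀ (mul_le_one₀ (mul_le_one₀ (mul_le_one₀ (hc _) (sq_nonneg _) (hs _)) (sq_nonneg _) (hc _))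
    (sq_nonneg _) (hc _)) (sq_nonneg _) (hs _)) (sq_nonneg _) (hc _)

lemma hexagonWeight_update (θ : Fin 6 → ℝ) (n : Fin 6) :
    hexagonWeight (Function.update θ n (θ n + 2 * π)) = hexagonWeight θ := by
  fin_cases n <;> simp [hexagonWeight]

lemma hexagonWeight_gaugeShift (θ : Fin 6 → ℝ) (η : ℝ) :
    hexagonWeight (gaugeShift (-η) + θ) =
      cos (θ 0 - η)^2 * sin (θ 1 + η)^2 * cos (θ 2 - η)^2 *
        cos (θ 3 + η)^2 * sin (θ 4 - η)^2 * cos (θ 5 + η)^2 := by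
  simp [hexagonWeight, gaugeShift, add_comm, sub_eq_add_neg]

lemma hexagonWeight_gaugeShift_pi_div_two (θ : Fin 6 → ℝ) :
    hexagonWeight (gaugeShift (-(π / 2)) + θ) =
      sin (θ 0)^2 * cos (θ 1)^2 * sin (θ 2)^2 *
        sin (θ 3)^2 * cos (θ 4)^2 * sin (θ 5)^2 := by
  simp [hexagonWeight_gaugeShift, cos_sub_pi_div_two, sin_sub_pi_div_two, cos_add_pi_div_two,
    sin_add_pi_div_two]

/-- **Independence of the Higgs target set for gauge-invariant observables
(hexagon instance).** Let `f(θ,η)` be `2π`-periodic in each of its 7 arguments,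
integrable on `[0,2π]^7` and gauge invariant:
`f(θ₁+α, θ₂−α, θ₃+α, θ₄−α, θ₅+α, θ₆−α, η+α) = f(θ,η)`.  Then the expectation of
`f` over the discrete Higgs field `S = {1,i}` at the interior vertex (terms
`η = 0` and `η = π/2` against the weights `T₁`, `T₂`) equals its expectation
over the continuous Higgs field `S = U(1)` (against the weight
`D(θ,η) = T₁(θ₁−η, θ₂+η, θ₃−η, θ₄+η, θ₅−η, θ₆+η)`). -/
theorem stmt_10 (f : (Fin 6 → ℝ) → ℝ → ℝ)
    (hf_per : ∀ (θ : Fin 6 → ℝ) (η : ℝ) (n : Fin 6),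
      f (Function.update θ n (θ n + 2*π)) η = f θ η)
    (hf_per' : ∀ (θ : Fin 6 → ℝ) (η : ℝ), f θ (η + 2*π) = f θ η)
    (hf_int : IntegrableOn (fun p : (Fin 6 → ℝ) × ℝ => f p.1 p.2)
      ((Set.univ.pi fun _ => Set.Icc (0:ℝ) (2*π)) ×ˢ Set.Icc (0:ℝ) (2*π)) volume)
    (hf_gauge : ∀ (θ : Fin 6 → ℝ) (α η : ℝ),
      f (fun n => θ n + (if (n : ℕ) % 2 = 0 then α else -α)) (η + α) = f θ η) :
    (1/(2*π^6)) *
      ((∫ θ : Fin 6 → ℝ in Set.univ.pi (fun _ => Set.Icc (0:ℝ) (2*π)),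
          f θ 0 * (cos (θ 0)^2 * sin (θ 1)^2 * cos (θ 2)^2 *
                   cos (θ 3)^2 * sin (θ 4)^2 * cos (θ 5)^2))
        + (∫ θ : Fin 6 → ℝ in Set.univ.pi (fun _ => Set.Icc (0:ℝ) (2*π)),
          f θ (π/2) * (sin (θ 0)^2 * cos (θ 1)^2 * sin (θ 2)^2 *
                       sin (θ 3)^2 * cos (θ 4)^2 * sin (θ 5)^2)))
    = (1/(2*π*π^6)) *
        ∫ p : (Fin 6 → ℝ) × ℝ in
          (Set.univ.pi fun _ => Set.Icc (0:ℝ) (2*π)) ×ˢ Set.Icc (0:ℝ) (2*π),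
          f p.1 p.2 *
            (cos (p.1 0 - p.2)^2 * sin (p.1 1 + p.2)^2 * cos (p.1 2 - p.2)^2 *
             cos (p.1 3 + p.2)^2 * sin (p.1 4 - p.2)^2 * cos (p.1 5 + p.2)^2) := by
  have hgauge (θ : Fin 6 → ℝ) (η : ℝ) : f θ η = f (gaugeShift (-η) + θ) 0 := by
    rw [← hf_gauge (gaugeShift (-η) + θ) η 0, zero_add]
    congr 1
    ext n
    simp only [gaugeShift, Pi.add_apply]
    split_ifs <;> ring
  set G : (Fin 6 → ℝ) → ℝ := fun θ => f θ 0 * hexagonWeight θ with hG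
  have hG_shift (θ : Fin 6 → ℝ) (η : ℝ) :
      f θ η * hexagonWeight (gaugeShift (-η) + θ) = G (gaugeShift (-η) + θ) := by
    rw [hG, hgauge θ η]
  have hG_int (c : Fin 6 → ℝ) :=
    setIntegral_pi_Icc_comp_add (G := G) two_pi_pos
      (fun θ n => by simp only [hG, hf_per, hexagonWeight_update]) c
  have hcont : Continuous fun p : (Fin 6 → ℝ) × ℝ => hexagonWeight (gaugeShift (-p.2) + p.1) :=
    continuous_hexagonWeight.comp
      ((continuous_gaugeShift.comp continuous_snd.neg).add continuous_fst)
  have hint := Integrable.mul_bdd hf_int hcont.aestronglyMeasurable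
    (.of_forall fun p => norm_hexagonWeight_le (gaugeShift (-p.2) + p.1))
  simp only [hG_shift] at hint
  simp only [← hexagonWeight_gaugeShift, ← hexagonWeight_gaugeShift_pi_div_two, hG_shift, hG_int]
  rw [Measure.volume_eq_prod, ← setIntegral_prod_swap,
    setIntegral_prod _ (by
      rw [IntegrableOn, ← Measure.prod_restrict]
      rw [Measure.volume_eq_prod, ← Measure.prod_restrict] at hint
      exact hint.swap)]
  simp only [Prod.fst_swap, Prod.snd_swap, hG_int, setIntegral_const, measureReal_def,
    Real.volume_Icc, sub_zero, ENNReal.toReal_ofReal two_pi_pos.le, smul_eq_mul]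
  change 1 / (2 * π ^ 6) * ((∫ θ in _, G θ) + _) = _
  field_simp
  ring
end
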